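/- arXiv:2204.10518 — 2 statements merged into one kernel-verified Lean document; each statement's English description precedes it below -/
import Mathlib

section
/- Let F be a field and let S be a cancellative semigroup such that the semigroup algebra FS has a classical right ring of fractions Q. If Q is a centrally essential ring, then FS is a centrally essential ring. -/
/-- A (not necessarily unital) ring `R` is centrally essential if for every element `a`
not lying in the center, there exist nonzero central elements `x, y` with `a * x = y`. -/
def IsCentrallyEssential (R : Type*) [NonUnitalNonAssocSemiring R] : Prop :=
  ∀ a : R, a ∉ Set.center R →
    ∃ x y : R, x ∈ Set.center R ∧ y ∈ Set.center R ∧ x ≠ 0 ∧ y ≠ 0 ∧ a * x = y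

/-- An element `r` is a (two-sided) non-zero-divisor. -/
def IsNonZeroDivisor {R : Type*} [NonUnitalNonAssocSemiring R] (r : R) : Prop :=
  (∀ x : R, r * x = 0 → x = 0) ∧ (∀ x : R, x * r = 0 → x = 0)

/-- `Q` (together with the injective ring homomorphism `φ : R → Q`) is a classical right
ring of fractions of `R`: every non-zero-divisor of `R` becomes invertible in `Q`, and
every element of `Q` has the form `φ a * (φ b)⁻¹` with `b` a non-zero-divisor of `R`. -/
structure IsClassicalRightRingOfFractions (R : Type*) [NonUnitalNonAssocSemiring R]
    (Q : Type*) [Ring Q] (φ : R →ₙ+* Q) : Prop where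
  inj : Function.Injective φ
  isUnit : ∀ b : R, IsNonZeroDivisor b → IsUnit (φ b)
  num_denom : ∀ q : Q, ∃ a b : R, IsNonZeroDivisor b ∧ q * φ b = φ a

theorem uniqueProds_of_isMulTorsionFree {T : Type*} [CommGroup T] [IsMulTorsionFree T] :
    UniqueProds T where
  uniqueMul_of_nonempty {A B} hA hB := by
    classical
    let H := Subgroup.closure (↑(A ∪ B) : Set T)
    have hAB : ∀ t ∈ A ∪ B, t ∈ H := fun t ht ↦ Subgroup.subset_closure (by exact_mod_cast ht)
    have hfg : Group.FG H := Group.closure_finset_fg _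
    have : Monoid.FG H := Group.fg_iff_monoid_fg.mp hfg
    have hU : UniqueProds H := inferInstance
    obtain ⟨a0, ha0, b0, hb0, h⟩ := hU.uniqueMul_of_nonempty
      (A := A.preimage ((↑) : H → T) Subtype.val_injective.injOn)
      (B := B.preimage ((↑) : H → T) Subtype.val_injective.injOn)
      (hA.elim fun a ha ↦ ⟨⟨a, hAB a (Finset.mem_union_left _ ha)⟩, by simpa using ha⟩)
      (hB.elim fun b hb ↦ ⟨⟨b, hAB b (Finset.mem_union_right _ hb)⟩, by simpa using hb⟩)
    refine ⟨a0, by simpa using ha0, b0, by simpa using hb0, fun a b ha hb hab ↦ ?_⟩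
    have := @h ⟨a, hAB a (Finset.mem_union_left _ ha)⟩ ⟨b, hAB b (Finset.mem_union_right _ hb)⟩
      (by simpa using ha) (by simpa using hb) (Subtype.ext hab)
    exact ⟨congrArg Subtype.val this.1, congrArg Subtype.val this.2⟩

theorem finite_closure_of_isOfFinOrder {G : Type*} [Group G] {A : Set G} (hA : A.Finite)
    (hcomm : ∀ x ∈ A, ∀ y ∈ A, x * y = y * x) (hord : ∀ x ∈ A, IsOfFinOrder x) :
    Finite (Subgroup.closure A) := by
  have := Subgroup.isMulCommutative_closure hcomm
  have hfg : Group.FG (Subgroup.closure A) :=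
    (Group.fg_iff_subgroup_fg _).mpr ⟨hA.toFinset, by simp⟩
  have htor : ∀ x ∈ Subgroup.closure A, IsOfFinOrder x := by
    intro x hx
    induction hx using Subgroup.closure_induction with
    | mem x hx => exact hord x hx
    | one => exact IsOfFinOrder.one
    | mul x y hx hy ihx ihy =>
      exact Commute.isOfFinOrder_mul
        (congrArg Subtype.val (mul_comm' (⟨x, hx⟩ : Subgroup.closure A) ⟨y, hy⟩)) ihx ihy
    | inv x hx ih => exact ih.inv
  let _ : CommGroup (Subgroup.closure A) :=
    { (inferInstance : Group (Subgroup.closure A)) with mul_comm := mul_comm' }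
  refine CommGroup.finite_of_fg_isMulTorsion _ fun x ↦ ?_
  exact Submonoid.isOfFinOrder_coe.mp (htor x x.2)

/-- If the coset of `s` modulo a finite normal subgroup is central, then some positive power of
`s` is central. -/
theorem exists_pow_mem_center {G : Type*} [Group G] (U : Subgroup G) [U.Normal] [Finite U] {s : G}
    (hs : (s : G ⧸ U) ∈ Subgroup.center (G ⧸ U)) : ∃ k, 0 < k ∧ s ^ k ∈ Subgroup.center G := by
  classical
  have hpow : ∀ u : U, ∃ k, 0 < k ∧ (s * u) ^ k = s ^ k := by
    intro u
    have hmem : ∀ i : ℕ, (s ^ i)⁻¹ * (s * u) ^ i ∈ U := by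
      intro i
      rw [← QuotientGroup.eq]
      simp
    obtain ⟨i, j, hij, h⟩ := Finite.exists_ne_map_eq_of_infinite
      (fun i : ℕ ↦ (⟨_, hmem i⟩ : U))
    wlog hlt : i < j generalizing i j
    · exact this j i hij.symm h.symm (by omega)
    have h' : (s ^ i)⁻¹ * (s * u) ^ i = (s ^ j)⁻¹ * (s * u) ^ j := congrArg Subtype.val h
    obtain ⟨d, rfl⟩ := Nat.exists_eq_add_of_lt hlt
    refine ⟨d + 1, by omega, ?_⟩
    rw [show i + d + 1 = (d + 1) + i by omega, pow_add _ _ i, pow_add _ _ i, mul_inv_rev,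
      mul_assoc, mul_left_cancel_iff, ← mul_assoc, right_eq_mul, inv_mul_eq_one] at h'
    exact h'.symm
  choose k hk0 hk using hpow
  have := Fintype.ofFinite U
  refine ⟨∏ u, k u, Finset.prod_pos fun u _ ↦ hk0 u, ?_⟩
  rw [Subgroup.mem_center_iff]
  intro g
  have hu : s⁻¹ * (g * s * g⁻¹) ∈ U := by
    rw [← QuotientGroup.eq]
    have := Subgroup.mem_center_iff.mp hs g
    simp [this]
  obtain ⟨d, hd⟩ := Finset.dvd_prod_of_mem k (Finset.mem_univ (⟨_, hu⟩ : U))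
  have h := hk ⟨_, hu⟩
  simp only [mul_inv_cancel_left, conj_pow] at h
  rw [hd, pow_mul, ← mul_inv_eq_iff_eq_mul, ← conj_pow, h]

/-- A finitely generated subgroup which is commutative modulo a finite normal subgroup `U` and
whose generators are torsion modulo a central subgroup `T` lies in finitely many cosets of `T`. -/
theorem exists_finite_closure_subset_mul {G : Type*} [Group G] (U T : Subgroup G) [U.Normal]
    [Finite U] (hT : T ≤ Subgroup.center G) {A : Set G} (hA : A.Finite)
    (hAU : ∀ a ∈ A, (a : G ⧸ U) ∈ Subgroup.center (G ⧸ U))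
    (hAT : ∀ a ∈ A, ∃ d, 0 < d ∧ a ^ d ∈ T) :
    ∃ W : Set G, W.Finite ∧ ∀ g ∈ Subgroup.closure A, ∃ w ∈ W, ∃ t ∈ T, g = w * t := by
  classical
  have hTn : T.Normal := ⟨fun t ht g ↦ by
    rwa [Subgroup.mem_center_iff.mp (hT ht) g, mul_inv_cancel_right]⟩
  let M := U ⊔ T
  let A' : Set (G ⧸ M) := (QuotientGroup.mk' M) '' A
  have hcomm : ∀ x ∈ A', ∀ y ∈ A', x * y = y * x := by
    rintro _ ⟨a, ha, rfl⟩ _ ⟨b, hb, rfl⟩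
    have h := Subgroup.mem_center_iff.mp (hAU a ha) b
    rw [← map_mul, ← map_mul]
    rw [← QuotientGroup.mk_mul, ← QuotientGroup.mk_mul, QuotientGroup.eq] at h
    exact (QuotientGroup.eq.mpr (Subgroup.mem_sup_left h)).symm
  have hfin : Finite (Subgroup.closure A') := by
    refine finite_closure_of_isOfFinOrder (hA.image _) hcomm ?_
    rintro _ ⟨a, ha, rfl⟩
    obtain ⟨d, hd, had⟩ := hAT a ha
    refine isOfFinOrder_iff_pow_eq_one.mpr ⟨d, hd, ?_⟩
    rw [← map_pow]
    exact (QuotientGroup.eq_one_iff _).mpr (Subgroup.mem_sup_right had)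
  let N' : Set (G ⧸ M) := Subgroup.closure A'
  have hN' : N'.Finite := hfin
  refine ⟨Set.image2 (fun y (u : G) ↦ y * u) (Quotient.out '' N') U,
    (hN'.image _).image2 _ ‹Finite U›, fun g hg ↦ ?_⟩
  have hgN : (g : G ⧸ M) ∈ N' := by
    have : QuotientGroup.mk' M g ∈ (Subgroup.closure A).map (QuotientGroup.mk' M) :=
      Subgroup.mem_map_of_mem _ hg
    rwa [MonoidHom.map_closure] at this
  have hgM : (Quotient.out (g : G ⧸ M))⁻¹ * g ∈ M := by
    rw [← QuotientGroup.eq]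
    simp
  obtain ⟨u, hu, t, ht, hut⟩ := Subgroup.mem_sup_of_normal_right.mp hgM
  exact ⟨_, ⟨_, ⟨_, hgN, rfl⟩, u, hu, rfl⟩, t, ht, by simp [mul_assoc, hut]⟩

/-- The center of a group has a torsion-free subgroup modulo which it is torsion. -/
theorem exists_torsionFree_subgroup_center (G : Type*) [Group G] :
    ∃ T : Subgroup G, T ≤ Subgroup.center G ∧ (∀ t ∈ T, IsOfFinOrder t → t = 1) ∧
      ∀ z ∈ Subgroup.center G, ∃ d, 0 < d ∧ z ^ d ∈ T := by
  obtain ⟨T, -, hT⟩ := zorn_le_nonempty₀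
    {T : Subgroup G | T ≤ Subgroup.center G ∧ ∀ t ∈ T, IsOfFinOrder t → t = 1}
    (fun c hc hchain T hT ↦ ⟨sSup c, ⟨sSup_le fun H hH ↦ (hc hH).1, fun t ht ↦ by
      obtain ⟨H, hH, htH⟩ := (Subgroup.mem_sSup_of_directedOn ⟨T, hT⟩ hchain.directedOn).mp ht
      exact (hc hH).2 t htH⟩, fun H hH ↦ le_sSup hH⟩)
    ⊥ ⟨bot_le, fun t ht _ ↦ Subgroup.mem_bot.mp ht⟩
  refine ⟨T, hT.prop.1, hT.prop.2, fun z hz ↦ ?_⟩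
  by_contra! hd
  have hTn : T.Normal := ⟨fun t ht g ↦ by
    rwa [Subgroup.mem_center_iff.mp (hT.prop.1 ht) g, mul_inv_cancel_right]⟩
  have hle : T ⊔ Subgroup.zpowers z ≤ T := hT.le_of_ge
    ⟨sup_le hT.prop.1 (by simpa using hz), fun x hx hfin ↦ ?_⟩ le_sup_left
  · exact hd 1 one_pos (hle (Subgroup.mem_sup_right (by simp)))
  obtain ⟨t, ht, y, ⟨m, rfl⟩, rfl⟩ := Subgroup.mem_sup_of_normal_left.mp hx
  obtain ⟨n, hn, hpow⟩ := isOfFinOrder_iff_pow_eq_one.mp hfin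
  have hm : m = 0 := by
    by_contra hm
    have hcomm : Commute t (z ^ m) := (Subgroup.mem_center_iff.mp (hT.prop.1 ht) _).symm
    have hzT : z ^ (m * n) ∈ T := by
      simp only [hcomm.mul_pow, mul_eq_one_iff_inv_eq] at hpow
      rw [zpow_mul, zpow_natCast, ← hpow]
      exact inv_mem (pow_mem ht n)
    refine hd (m * n).natAbs (by simp [hm]; omega) ?_
    rcases Int.natAbs_eq (m * n) with h | h
    · rw [← zpow_natCast, ← h]; exact hzT
    · rw [← inv_mem_iff, ← zpow_natCast, ← zpow_neg, ← h]; exact hzT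
  subst hm
  simp only [zpow_zero, mul_one] at hfin ⊢
  exact hT.prop.2 t ht hfin

/-- The product of nonzero elements of a semigroup algebra is nonzero if the first factor is
supported in a torsion-free commutative subgroup `T` of a group containing the semigroup. -/
theorem MonoidAlgebra.mul_ne_zero_of_support_mem {F S G : Type*} [Semiring F] [NoZeroDivisors F]
    [Semigroup S] [Group G] {j : S →ₙ* G} (hj : Function.Injective j) (T : Subgroup G)
    [UniqueProds T] {r c : MonoidAlgebra F S} (hr : ∀ s ∈ r.coeff.support, j s ∈ T)
    (hr0 : r ≠ 0) (hc0 : c ≠ 0) : r * c ≠ 0 := by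
  classical
  simp only [ne_eq, ← MonoidAlgebra.coeff_eq_zero, ← Finsupp.support_nonempty_iff] at hr0 hc0
  obtain ⟨s, hs⟩ := hr0
  obtain ⟨α, hα⟩ := hc0
  let A : Finset T := (r.coeff.support.image j).preimage _ Subtype.val_injective.injOn
  let B : Finset T := (c.coeff.support.image fun s ↦ j s * (j α)⁻¹).preimage _
    Subtype.val_injective.injOn
  have hA : A.Nonempty := ⟨⟨j s, hr s hs⟩, by
    simp only [A, Finset.mem_preimage]; exact Finset.mem_image_of_mem _ hs⟩
  have hB : B.Nonempty := ⟨1, by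
    simp only [B, Finset.mem_preimage, Finset.mem_image]; exact ⟨α, hα, by simp⟩⟩
  obtain ⟨a, ha, b, hb, hab⟩ := UniqueProds.uniqueMul_of_nonempty hA hB
  simp only [A, B, Finset.mem_preimage, Finset.mem_image] at ha hb
  obtain ⟨s₀, hs₀, hsa⟩ := ha
  obtain ⟨s₁, hs₁, hsb⟩ := hb
  have huniq : UniqueMul r.coeff.support c.coeff.support s₀ s₁ := by
    intro s s' hs hs' hss
    have hss' : j s * (j s' * (j α)⁻¹) = a * b := by
      rw [← mul_assoc, ← map_mul, hss, map_mul, mul_assoc, hsa, hsb]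
    have hT : j s' * (j α)⁻¹ ∈ T := by
      rw [← eq_inv_mul_iff_mul_eq] at hss'
      rw [hss']
      exact mul_mem (inv_mem (hr s hs)) (mul_mem a.2 b.2)
    have h := @hab ⟨j s, hr s hs⟩ ⟨_, hT⟩
      (by simp only [A, Finset.mem_preimage]; exact Finset.mem_image_of_mem _ hs)
      (by simp only [B, Finset.mem_preimage, Finset.mem_image]; exact ⟨s', hs', rfl⟩)
      (Subtype.ext hss')
    refine ⟨hj ((congrArg Subtype.val h.1).trans hsa.symm), hj ?_⟩
    exact mul_right_cancel ((congrArg Subtype.val h.2).trans hsb.symm)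
  intro h
  have := MonoidAlgebra.coeff_mul_mul_of_uniqueMul huniq
  rw [h, MonoidAlgebra.coeff_zero, Finsupp.zero_apply] at this
  exact mul_ne_zero (Finsupp.mem_support_iff.mp hs₀) (Finsupp.mem_support_iff.mp hs₁) this.symm

theorem MonoidAlgebra.exists_mul_eq_of_mem_support_mul {F S : Type*} [Semiring F] [Mul S]
    {x y : MonoidAlgebra F S} {γ : S} (h : γ ∈ (x * y).coeff.support) :
    ∃ α ∈ x.coeff.support, ∃ β ∈ y.coeff.support, α * β = γ := by
  classical
  by_contra! hne
  refine Finsupp.mem_support_iff.mp h ?_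
  rw [MonoidAlgebra.coeff_mul]
  exact Finset.sum_eq_zero fun α hα ↦ Finset.sum_eq_zero fun β hβ ↦ if_neg (hne α hα β hβ)

/-- The basis elements of the semigroup algebra of a cancellative semigroup are
non-zero-divisors. -/
theorem MonoidAlgebra.isNonZeroDivisor_single {F S : Type*} [Semiring F]
    [Semigroup S] [IsCancelMul S] (s : S) : IsNonZeroDivisor (single s (1 : F)) := by
  refine ⟨fun x hx ↦ ?_, fun x hx ↦ ?_⟩ <;> ext t
  · have := coeff_single_mul_eq_mul_coeff (r := (1 : F)) (x := x) (m := s) (m₁ := s * t) t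
      fun m _ ↦ mul_right_inj s
    simpa [hx] using this.symm
  · have := coeff_mul_single_eq_coeff_mul (r := (1 : F)) (x := x) (m := s) (m₁ := t * s) t
      fun m _ ↦ mul_left_inj s
    simpa [hx] using this.symm

/-- In a centrally essential ring, finitely many elements have a common nonzero central
multiplier sending them to the center. -/
theorem IsCentrallyEssential.exists_common_multiplier {Q : Type*} [Ring Q] [Nontrivial Q]
    (h : IsCentrallyEssential Q) {A : Set Q} (hA : A.Finite) :
    ∃ x ∈ Subring.center Q, x ≠ 0 ∧ ∀ a ∈ A, a * x ∈ Subring.center Q := by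
  induction A, hA using Set.Finite.induction_on with
  | empty => exact ⟨1, one_mem _, one_ne_zero, by simp⟩
  | insert _ _ ih =>
    rename_i a A _ _
    obtain ⟨x, hx, hx0, hxA⟩ := ih
    by_cases hax : a * x ∈ Subring.center Q
    · exact ⟨x, hx, hx0, by simpa [hax] using hxA⟩
    obtain ⟨y, z, hy, hz, -, hz0, rfl⟩ := h (a * x) hax
    refine ⟨x * y, mul_mem hx hy, fun h0 ↦ hz0 (by rw [mul_assoc, h0, mul_zero]), ?_⟩
    rintro b (rfl | hb)
    · rw [← mul_assoc]; exact hz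
    · rw [← mul_assoc]; exact mul_mem (hxA b hb) hy

theorem MonoidAlgebra.single_mem_center {F S : Type*} [CommSemiring F] [Semigroup S] {s : S}
    (hs : ∀ t, s * t = t * s) (a : F) : single s a ∈ Set.center (MonoidAlgebra F S) := by
  rw [Semigroup.mem_center_iff]
  intro x
  induction x using MonoidAlgebra.induction_linear with
  | zero => simp
  | add x y hx hy => rw [add_mul, mul_add, hx, hy]
  | single t b => rw [single_mul_single, single_mul_single, hs, mul_comm]

namespace IsClassicalRightRingOfFractions

section Ring

variable {R Q : Type*} [NonUnitalRing R] [Ring Q] {φ : R →ₙ+* Q}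

theorem map_mem_center (hQ : IsClassicalRightRingOfFractions R Q φ) {r : R}
    (hr : r ∈ Set.center R) : φ r ∈ Subring.center Q := by
  rw [Subring.mem_center_iff]
  intro q
  obtain ⟨a, b, hb, hq⟩ := hQ.num_denom q
  rw [Semigroup.mem_center_iff] at hr
  rw [← (hQ.isUnit b hb).mul_left_inj, mul_assoc, ← map_mul, ← hr, map_mul, ← mul_assoc, hq,
    mul_assoc, hq, ← map_mul, ← map_mul, hr]

theorem mem_center_of_map (hQ : IsClassicalRightRingOfFractions R Q φ) {r : R}
    (hr : φ r ∈ Subring.center Q) : r ∈ Set.center R := by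
  rw [Semigroup.mem_center_iff]
  intro x
  apply hQ.inj
  rw [map_mul, map_mul, Subring.mem_center_iff.mp hr]

/-- The subring of the fractions with denominators in a set `C` of central non-zero-divisors
(together with zero) and numerators in `E`. -/
def fractionSubring (hQ : IsClassicalRightRingOfFractions R Q φ) (C E : NonUnitalSubring R)
    (hC : ∀ c ∈ C, c ∈ Set.center R) (hC0 : ∀ c ∈ C, c ≠ 0 → IsNonZeroDivisor c) (hCE : C ≤ E)
    (hne : ∃ c ∈ C, c ≠ 0) : Subring Q where
  carrier := {q | ∃ c ∈ C, c ≠ 0 ∧ ∃ e ∈ E, φ c * q = φ e}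
  one_mem' := by
    obtain ⟨c, hc, hc0⟩ := hne
    exact ⟨c, hc, hc0, c, hCE hc, mul_one _⟩
  zero_mem' := by
    obtain ⟨c, hc, hc0⟩ := hne
    exact ⟨c, hc, hc0, 0, E.zero_mem, by simp⟩
  neg_mem' := by
    rintro q ⟨c, hc, hc0, e, he, h⟩
    exact ⟨c, hc, hc0, -e, E.neg_mem he, by simp [h]⟩
  mul_mem' := by
    rintro q q' ⟨c, hc, hc0, e, he, h⟩ ⟨c', hc', hc0', e', he', h'⟩
    refine ⟨c * c', C.mul_mem hc hc', fun h0 ↦ hc0' ((hC0 c hc hc0).1 _ h0), e * e',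
      E.mul_mem he he', ?_⟩
    have hcc := Subring.mem_center_iff.mp (hQ.map_mem_center (hC c' hc'))
    rw [map_mul, map_mul, ← h, ← h', mul_assoc, mul_assoc, ← mul_assoc _ q, ← hcc q, mul_assoc]
  add_mem' := by
    rintro q q' ⟨c, hc, hc0, e, he, h⟩ ⟨c', hc', hc0', e', he', h'⟩
    refine ⟨c * c', C.mul_mem hc hc', fun h0 ↦ hc0' ((hC0 c hc hc0).1 _ h0), c' * e + c * e',
      E.add_mem (E.mul_mem (hCE hc') he) (E.mul_mem (hCE hc) he'), ?_⟩
    have hcc := Subring.mem_center_iff.mp (hQ.map_mem_center (hC c' hc'))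
    rw [map_add, map_mul, map_mul, map_mul, ← h, ← h', mul_add, ← mul_assoc, ← hcc (φ c),
      mul_assoc (φ c) (φ c') q']

section fractionSubring

variable (hQ : IsClassicalRightRingOfFractions R Q φ) {C E : NonUnitalSubring R}
  (hC : ∀ c ∈ C, c ∈ Set.center R) (hC0 : ∀ c ∈ C, c ≠ 0 → IsNonZeroDivisor c)

theorem map_mem_fractionSubring (hCE : C ≤ E) (hne : ∃ c ∈ C, c ≠ 0) {e : R} (he : e ∈ E) :
    φ e ∈ hQ.fractionSubring C E hC hC0 hCE hne := by
  obtain ⟨c, hc, hc0⟩ := hne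
  exact ⟨c, hc, hc0, c * e, E.mul_mem (hCE hc) he, (map_mul _ _ _).symm⟩

theorem fractionSubring_mono (hCE : C ≤ E) (hne : ∃ c ∈ C, c ≠ 0) :
    hQ.fractionSubring C C hC hC0 le_rfl hne ≤ hQ.fractionSubring C E hC hC0 hCE hne := by
  rintro q ⟨c, hc, hc0, e, he, h⟩
  exact ⟨c, hc, hc0, e, hCE he, h⟩

theorem fractionSubring_le_center (hne : ∃ c ∈ C, c ≠ 0) :
    hQ.fractionSubring C C hC hC0 le_rfl hne ≤ Subring.center Q := by
  rintro q ⟨c, hc, hc0, e, he, h⟩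
  rw [Subring.mem_center_iff]
  intro x
  have hcc := Subring.mem_center_iff.mp (hQ.map_mem_center (hC c hc))
  rw [← (hQ.isUnit c (hC0 c hc hc0)).mul_right_inj, ← mul_assoc, ← mul_assoc, h, ← hcc, mul_assoc, h,
    Subring.mem_center_iff.mp (hQ.map_mem_center (hC e he))]

theorem exists_inv_mem_fractionSubring (hne : ∃ c ∈ C, c ≠ 0) {q : Q}
    (hq : q ∈ hQ.fractionSubring C C hC hC0 le_rfl hne) (hq0 : q ≠ 0) :
    ∃ q' ∈ hQ.fractionSubring C C hC hC0 le_rfl hne, q * q' = 1 := by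
  obtain ⟨c, hc, hc0, e, he, h⟩ := hq
  have hcu := hQ.isUnit c (hC0 c hc hc0)
  have he0 : e ≠ 0 := by
    rintro rfl
    rw [map_zero, hcu.mul_right_eq_zero] at h
    exact hq0 h
  obtain ⟨u, hu⟩ := hQ.isUnit e (hC0 e he he0)
  refine ⟨↑u⁻¹ * φ c, ⟨e, he, he0, c, hc, by rw [← hu, Units.mul_inv_cancel_left]⟩, ?_⟩
  rw [← hcu.mul_right_inj, ← mul_assoc, h, ← hu, Units.mul_inv_cancel_left, mul_one]

end fractionSubring

end Ring

section Semigroup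

variable {F S Q : Type*} [Field F] [Semigroup S] [IsCancelMul S] [Ring Q]
  {φ : MonoidAlgebra F S →ₙ+* Q}

open MonoidAlgebra

theorem exists_mulHom_units (hQ : IsClassicalRightRingOfFractions (MonoidAlgebra F S) Q φ) :
    ∃ ι : S →ₙ* Qˣ, Function.Injective ι ∧ ∀ s, (ι s : Q) = φ (single s 1) := by
  choose ι hι using fun s : S ↦ hQ.isUnit _ (isNonZeroDivisor_single (F := F) s)
  refine ⟨⟨ι, fun s t ↦ Units.ext ?_⟩, fun s t h ↦ ?_, hι⟩
  · rw [Units.val_mul, hι, hι, hι, ← map_mul, single_mul_single, one_mul]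
  · have h' := congrArg Units.val h
    simp only [MulHom.coe_mk, hι] at h'
    exact (MonoidAlgebra.single_left_inj one_ne_zero).mp (hQ.inj h')

/-- The group of right fractions of `S`. -/
theorem exists_fraction_group [Nontrivial Q] [Nonempty S]
    (hQ : IsClassicalRightRingOfFractions (MonoidAlgebra F S) Q φ) :
    ∃ (G : Subgroup Qˣ) (j : S →ₙ* G), Function.Injective j ∧
      (∀ s, ((j s : Qˣ) : Q) = φ (single s 1)) ∧ ∀ u : G, ∃ g h, u * j h = j g := by
  obtain ⟨ι, hι, hιφ⟩ := hQ.exists_mulHom_units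
  have hore : ∀ g h : S, ∃ α β, g * α = h * β := by
    intro g h
    obtain ⟨a, b, hb, hab⟩ := hQ.num_denom ↑((ι h)⁻¹ * ι g)
    have hba : single g 1 * b = single h 1 * a := by
      apply hQ.inj
      rw [map_mul, map_mul, ← hab, ← hιφ, ← hιφ, ← mul_assoc, ← Units.val_mul, mul_inv_cancel_left]
    have hb0 : b ≠ 0 := by
      rintro rfl
      have := hQ.isUnit _ hb
      simp at this
    have hne : single g 1 * b ≠ 0 := fun h0 ↦ hb0 ((isNonZeroDivisor_single g).1 _ h0)
    rw [ne_eq, ← MonoidAlgebra.coeff_eq_zero, ← ne_eq, ← Finsupp.support_nonempty_iff] at hne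
    obtain ⟨γ, hγ⟩ := hne
    obtain ⟨g', hg', α, -, h1⟩ := exists_mul_eq_of_mem_support_mul hγ
    rw [hba] at hγ
    obtain ⟨h', hh', β, -, h2⟩ := exists_mul_eq_of_mem_support_mul hγ
    have hg'' : g' = g := by simpa using Finsupp.support_single_subset hg'
    have hh'' : h' = h := by simpa using Finsupp.support_single_subset hh'
    exact ⟨α, β, by rw [← hg'', ← hh'', h1, h2]⟩
  let G : Subgroup Qˣ :=
    { carrier := {u | ∃ g h, u * ι h = ι g}
      one_mem' := (‹Nonempty S›).elim fun s ↦ ⟨s, s, one_mul _⟩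
      inv_mem' := by
        rintro u ⟨g, h, hu⟩
        exact ⟨h, g, by rw [← hu, inv_mul_cancel_left]⟩
      mul_mem' := by
        rintro u v ⟨g, h, hu⟩ ⟨g', h', hv⟩
        obtain ⟨α, β, hαβ⟩ := hore h g'
        refine ⟨g * α, h' * β, ?_⟩
        rw [map_mul, mul_assoc, ← mul_assoc v, hv, ← map_mul, ← hαβ, map_mul, ← mul_assoc, hu,
          map_mul] }
  refine ⟨G, ⟨fun s ↦ ⟨ι s, s * s, s, by rw [map_mul]⟩, fun s t ↦ Subtype.ext (map_mul ι s t)⟩,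
    fun s t h ↦ hι (congrArg Subtype.val h), hιφ, fun ⟨u, g, h, hu⟩ ↦ ⟨g, h, Subtype.ext hu⟩⟩

theorem exists_finite_normal_subgroup [Nontrivial Q]
    (hQ : IsClassicalRightRingOfFractions (MonoidAlgebra F S) Q φ) (h : IsCentrallyEssential Q)
    {G : Subgroup Qˣ} {j : S →ₙ* G} (hjφ : ∀ s, ((j s : Qˣ) : Q) = φ (single s 1))
    (hG : ∀ u : G, ∃ g h, u * j h = j g) {A : Set S} (hA : A.Finite) :
    ∃ (U : Subgroup G) (_ : U.Normal), Finite U ∧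
      ∀ s ∈ A, (j s : G ⧸ U) ∈ Subgroup.center (G ⧸ U) := by
  obtain ⟨x, hx, hx0, hxA⟩ := h.exists_common_multiplier (hA.image fun s ↦ φ (single s 1))
  rw [Subring.mem_center_iff] at hx
  let U : Subgroup G :=
    { carrier := {u | ((u : Qˣ) : Q) * x = x}
      one_mem' := one_mul x
      inv_mem' := by
        intro u hu
        change ((u : Qˣ) : Q) * x = x at hu
        change (((u⁻¹ : G) : Qˣ) : Q) * x = x
        rw [Subgroup.coe_inv, Units.inv_mul_eq_iff_eq_mul, hu]
      mul_mem' := by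
        intro u v hu hv
        change ((u : Qˣ) : Q) * x = x at hu
        change ((v : Qˣ) : Q) * x = x at hv
        change (((u * v : G) : Qˣ) : Q) * x = x
        rw [Subgroup.coe_mul, Units.val_mul, mul_assoc, hv, hu] }
  have hU : ∀ u : G, u ∈ U ↔ ((u : Qˣ) : Q) * x = x := fun u ↦ Iff.rfl
  have hUn : U.Normal := by
    refine ⟨fun u hu g ↦ ?_⟩
    rw [hU] at hu ⊢
    rw [Subgroup.coe_mul, Subgroup.coe_mul, Subgroup.coe_inv, Units.val_mul, Units.val_mul,
      mul_assoc, hx, ← mul_assoc, mul_assoc ((g : Qˣ) : Q), hu, hx, mul_assoc, Units.mul_inv, mul_one]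
  refine ⟨U, hUn, ?_, fun s hs ↦ ?_⟩
  · obtain ⟨c, b, hb, hcb⟩ := hQ.num_denom x
    have hc0 : c ≠ 0 := by
      rintro rfl
      rw [map_zero, (hQ.isUnit b hb).mul_left_eq_zero] at hcb
      exact hx0 hcb
    obtain ⟨α, hα⟩ : c.coeff.support.Nonempty := by
      rwa [Finsupp.support_nonempty_iff, ne_eq, coeff_eq_zero]
    refine ((c.coeff.support.finite_toSet.image fun β ↦ (j β)⁻¹ * j α).subset fun u hu ↦ ?_)
    have hcu : φ c * ((u : Qˣ) : Q) = φ c := by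
      rw [← hcb, ← hx, mul_assoc, ← hx, (hU u).mp hu]
    obtain ⟨g, h, hgh⟩ := hG u
    have hgh' : c * single g 1 = c * single h 1 := by
      apply hQ.inj
      rw [map_mul, map_mul, ← hjφ, ← hgh, Subgroup.coe_mul, Units.val_mul, ← mul_assoc, hcu, hjφ]
    have hαh : α * h ∈ (c * single h 1).coeff.support := by
      rw [Finsupp.mem_support_iff, coeff_mul_single_eq_coeff_mul α fun m _ ↦ mul_left_inj h, mul_one]
      exact Finsupp.mem_support_iff.mp hα
    rw [← hgh'] at hαh
    obtain ⟨β, hβ, g', hg', hβg⟩ := exists_mul_eq_of_mem_support_mul hαh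
    have hg'' : g' = g := by simpa using Finsupp.support_single_subset hg'
    refine ⟨β, hβ, ?_⟩
    rw [hg''] at hβg
    have := congrArg j hβg
    rw [map_mul, map_mul, ← hgh, ← mul_assoc, mul_left_inj] at this
    exact inv_mul_eq_of_eq_mul this.symm
  · rw [Subgroup.mem_center_iff]
    intro v
    induction v using QuotientGroup.induction_on with
    | H u =>
      have hsx := Subring.mem_center_iff.mp (hxA _ ⟨s, hs, rfl⟩) ((u : Qˣ) : Q)
      simp only [← hjφ] at hsx
      rw [← QuotientGroup.mk_mul, ← QuotientGroup.mk_mul, QuotientGroup.eq, hU, Subgroup.coe_mul,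
        Subgroup.coe_inv, Units.val_mul, mul_assoc, Units.inv_mul_eq_iff_eq_mul, Subgroup.coe_mul,
        Subgroup.coe_mul, Units.val_mul, Units.val_mul, mul_assoc, mul_assoc, hsx, mul_assoc, hx]

end Semigroup

end IsClassicalRightRingOfFractions

theorem exists_mul_eq_algebraMap_of_closure_subset_span {K B : Type*} [Field K] [Ring B]
    [Algebra K B] {A W : Set B} (hW : W.Finite)
    (hAW : ∀ g ∈ Submonoid.closure A, g ∈ Submodule.span K W) {b : B}
    (hb : b ∈ Algebra.adjoin K A) (hb0 : b ∈ nonZeroDivisors B) :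
    ∃ t ∈ Algebra.adjoin K {b}, ∃ κ : K, κ ≠ 0 ∧ b * t = algebraMap K B κ := by
  have hle : Subalgebra.toSubmodule (Algebra.adjoin K A) ≤ Submodule.span K W := by
    rw [Algebra.adjoin_eq_span, Submodule.span_le]
    exact hAW
  have := FiniteDimensional.span_of_finite K hW
  have := Submodule.finiteDimensional_of_le hle
  have hint : IsIntegral K b :=
    IsIntegral.of_mem_of_fg _ (Module.Finite.iff_fg.mp this) b hb
  obtain ⟨t, ht, κ, hκ, h⟩ := hint.isAlgebraic.exists_nonzero_eq_adjoin_mul hb0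
  exact ⟨t, ht, κ, hκ, h⟩

/-- The elements of a semigroup algebra which are supported in the preimage of a subgroup. -/
def MonoidAlgebra.supportedInSubgroup (F : Type*) {S G : Type*} [Ring F] [Semigroup S] [Group G]
    (j : S →ₙ* G) (T : Subgroup G) : NonUnitalSubring (MonoidAlgebra F S) where
  carrier := {r | ∀ s ∈ r.coeff.support, j s ∈ T}
  zero_mem' := by simp
  neg_mem' := by
    intro x hx s hs
    rw [coeff_neg, Finsupp.support_neg] at hs
    exact hx s hs
  add_mem' := by
    classical
    intro x y hx hy s hs
    rw [coeff_add] at hs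
    rcases Finset.mem_union.mp (Finsupp.support_add hs) with h | h
    exacts [hx s h, hy s h]
  mul_mem' := by
    intro x y hx hy s hs
    obtain ⟨α, hα, β, hβ, rfl⟩ := exists_mul_eq_of_mem_support_mul hs
    rw [map_mul]
    exact mul_mem (hx α hα) (hy β hβ)

theorem MonoidAlgebra.single_mem_supportedInSubgroup (F : Type*) {S G : Type*} [Ring F]
    [Semigroup S] [Group G] {j : S →ₙ* G} {T : Subgroup G} {s : S} (hs : j s ∈ T) (a : F) :
    single s a ∈ supportedInSubgroup F j T := by
  intro t ht
  have : t = s := by simpa using Finsupp.support_single_subset ht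
  rwa [this]

theorem MonoidAlgebra.mem_center_of_mem_supportedInSubgroup {F S G : Type*} [CommRing F]
    [Semigroup S] [Group G] {j : S →ₙ* G} (hj : Function.Injective j) {T : Subgroup G}
    (hT : T ≤ Subgroup.center G) {r : MonoidAlgebra F S} (hr : r ∈ supportedInSubgroup F j T) :
    r ∈ Set.center (MonoidAlgebra F S) := by
  rw [← sum_coeff_single r]
  refine sum_mem (S := NonUnitalSubring.center (MonoidAlgebra F S)) fun s hs ↦ ?_
  refine single_mem_center (fun t ↦ hj ?_) _
  rw [map_mul, map_mul, Subgroup.mem_center_iff.mp (hT (hr s hs))]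

theorem MonoidAlgebra.isNonZeroDivisor_of_mem_supportedInSubgroup {F S G : Type*} [Field F]
    [Semigroup S] [Group G] {j : S →ₙ* G} (hj : Function.Injective j) {T : Subgroup G}
    (hT : T ≤ Subgroup.center G) [UniqueProds T] {r : MonoidAlgebra F S}
    (hr : r ∈ supportedInSubgroup F j T) (hr0 : r ≠ 0) : IsNonZeroDivisor r := by
  have h : ∀ x, r * x = 0 → x = 0 := fun x hx ↦ by
    by_contra hx0
    exact mul_ne_zero_of_support_mem hj T hr hr0 hx0 hx
  refine ⟨h, fun x hx ↦ h x ?_⟩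
  rwa [← Semigroup.mem_center_iff.mp (mem_center_of_mem_supportedInSubgroup hj hT hr)]

theorem exists_uniqueProds_subgroup_center (G : Type*) [Group G] :
    ∃ T : Subgroup G, T ≤ Subgroup.center G ∧ UniqueProds T ∧
      ∀ z ∈ Subgroup.center G, ∃ d, 0 < d ∧ z ^ d ∈ T := by
  obtain ⟨T, hT, hfree, hpow⟩ := exists_torsionFree_subgroup_center G
  refine ⟨T, hT, ?_, hpow⟩
  let _ : CommGroup T :=
    { (inferInstance : Group T) with
      mul_comm := fun a b ↦ Subtype.ext (Subgroup.mem_center_iff.mp (hT b.2) a) }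
  have : IsMulTorsionFree T := IsMulTorsionFree.of_not_isOfFinOrder fun a ha hfin ↦
    ha (Subtype.ext (hfree a a.2 (Submonoid.isOfFinOrder_coe.mpr hfin)))
  exact uniqueProds_of_isMulTorsionFree

theorem MulHom.exists_map_eq_pow {S G : Type*} [Semigroup S] [Monoid G] (j : S →ₙ* G) (s : S)
    {n : ℕ} (hn : 0 < n) : ∃ t, j t = j s ^ n := by
  induction n, hn using Nat.le_induction with
  | base => exact ⟨s, (pow_one _).symm⟩
  | succ n _ ih =>
    obtain ⟨t, ht⟩ := ih
    exact ⟨t * s, by rw [map_mul, ht, pow_succ]⟩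

namespace IsClassicalRightRingOfFractions

section

variable {F S Q : Type*} [Field F] [Semigroup S] [IsCancelMul S] [Ring Q]
  {φ : MonoidAlgebra F S →ₙ+* Q}

open MonoidAlgebra

/-- If `Q` is centrally essential, every non-zero-divisor of the semigroup algebra has a nonzero
right multiple supported in a torsion-free central subgroup `T` of the group of fractions. -/
theorem exists_mul_mem_supportedInSubgroup [Nontrivial Q]
    (hQ : IsClassicalRightRingOfFractions (MonoidAlgebra F S) Q φ) (h : IsCentrallyEssential Q)
    {G : Subgroup Qˣ} {j : S →ₙ* G} (hj : Function.Injective j)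
    (hjφ : ∀ s, ((j s : Qˣ) : Q) = φ (single s 1)) (hG : ∀ u : G, ∃ g h, u * j h = j g)
    {T : Subgroup G} (hT : T ≤ Subgroup.center G) [UniqueProds T]
    (hTpow : ∀ z ∈ Subgroup.center G, ∃ d, 0 < d ∧ z ^ d ∈ T) {b : MonoidAlgebra F S}
    (hb : IsNonZeroDivisor b) : ∃ r, b * r ∈ supportedInSubgroup F j T ∧ b * r ≠ 0 := by
  obtain ⟨U, hU, hUfin, hbU⟩ :=
    hQ.exists_finite_normal_subgroup h hjφ hG b.coeff.support.finite_toSet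
  have hpow : ∀ s ∈ b.coeff.support, ∃ d, 0 < d ∧ ∃ t, j t = j s ^ d ∧ j t ∈ T := by
    intro s hs
    obtain ⟨k, hk, hkc⟩ := exists_pow_mem_center U (hbU s hs)
    obtain ⟨d, hd, hdT⟩ := hTpow _ hkc
    obtain ⟨t, ht⟩ := j.exists_map_eq_pow s (Nat.mul_pos hk hd)
    exact ⟨k * d, Nat.mul_pos hk hd, t, ht, by rwa [ht, pow_mul]⟩
  have hb0 : b ≠ 0 := by
    rintro rfl
    have := hQ.isUnit _ hb
    simp at this
  obtain ⟨p, hp⟩ : ∃ p, j p ∈ T := by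
    rw [ne_eq, ← coeff_eq_zero, ← ne_eq, ← Finsupp.support_nonempty_iff] at hb0
    obtain ⟨s, hs⟩ := hb0
    obtain ⟨-, -, t, -, ht⟩ := hpow s hs
    exact ⟨t, ht⟩
  let C := supportedInSubgroup F j T
  have hC : ∀ c ∈ C, c ∈ Set.center (MonoidAlgebra F S) := fun c hc ↦
    mem_center_of_mem_supportedInSubgroup hj hT hc
  have hC0 : ∀ c ∈ C, c ≠ 0 → IsNonZeroDivisor c := fun c hc hc0 ↦
    isNonZeroDivisor_of_mem_supportedInSubgroup hj hT hc hc0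
  have hne : ∃ c ∈ C, c ≠ 0 := ⟨single p 1, single_mem_supportedInSubgroup F hp 1, by simp⟩
  let K := hQ.fractionSubring C C hC hC0 le_rfl hne
  let L := hQ.fractionSubring C ⊤ hC hC0 le_top hne
  have hKc : ∀ k : K, ∀ q : Q, (k : Q) * q = q * k := fun k q ↦
    (Subring.mem_center_iff.mp (hQ.fractionSubring_le_center hC hC0 hne k.2) q).symm
  have hK : IsField K :=
    { exists_pair_ne := exists_pair_ne K
      mul_comm := fun x y ↦ Subtype.ext (hKc x y)
      mul_inv_cancel := fun {x} hx ↦ by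
        obtain ⟨y, hy, hxy⟩ := hQ.exists_inv_mem_fractionSubring hC hC0 hne x.2
          fun h0 ↦ hx (Subtype.ext h0)
        exact ⟨⟨y, hy⟩, Subtype.ext hxy⟩ }
  let _ : Field K := hK.toField
  let _ : Algebra K Q := RingHom.toAlgebra' K.subtype hKc
  have hsmul : ∀ (k : K) (q : Q), k • q = k * q := fun _ _ ↦ rfl
  let v : G →* Q := (Units.coeHom Q).comp G.subtype
  have hv : ∀ s, v (j s) = φ (single s 1) := hjφ
  let A : Set G := j '' b.coeff.support
  obtain ⟨W, hW, hAW⟩ := exists_finite_closure_subset_mul U (Subgroup.closure (T ∩ Set.range j))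
    (((Subgroup.closure_le T).mpr Set.inter_subset_left).trans hT) (A := A)
    (b.coeff.support.finite_toSet.image j) (by rintro _ ⟨s, hs, rfl⟩; exact hbU s hs) (by
      rintro _ ⟨s, hs, rfl⟩
      obtain ⟨d, hd, t, ht, htT⟩ := hpow s hs
      exact ⟨d, hd, Subgroup.subset_closure ⟨ht ▸ htT, t, ht⟩⟩)
  have hTK : ∀ t ∈ Subgroup.closure (T ∩ Set.range j), v t ∈ K := by
    intro t ht
    induction ht using Subgroup.closure_induction with
    | mem t ht =>
      obtain ⟨ht, s, rfl⟩ := ht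
      rw [hv]
      exact hQ.map_mem_fractionSubring hC hC0 le_rfl hne (single_mem_supportedInSubgroup F ht 1)
    | one => rw [map_one]; exact K.one_mem
    | mul x y _ _ hx hy => rw [map_mul]; exact K.mul_mem hx hy
    | inv x _ hx =>
      have hx0 : v x ≠ 0 := ((x : Qˣ).isUnit).ne_zero
      obtain ⟨y, hy, hxy⟩ := hQ.exists_inv_mem_fractionSubring hC hC0 hne hx hx0
      have : v x⁻¹ = y := by
        rw [← mul_one (v x⁻¹), ← hxy, ← mul_assoc, ← map_mul, inv_mul_cancel, map_one, one_mul]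
      rwa [this]
  have hspan : ∀ g ∈ Submonoid.closure (v '' A), g ∈ Submodule.span K (v '' W) := by
    intro g hg
    rw [← MonoidHom.map_mclosure] at hg
    obtain ⟨g, hg, rfl⟩ := hg
    obtain ⟨w, hw, t, ht, rfl⟩ := hAW g (Subgroup.le_closure_toSubmonoid A hg)
    have : v (w * t) = (⟨v t, hTK t ht⟩ : K) • v w := by
      rw [hsmul, hKc, map_mul]
    rw [this]
    exact Submodule.smul_mem _ _ (Submodule.subset_span ⟨w, hw, rfl⟩)
  have hbA : φ b ∈ Algebra.adjoin K (v '' A) := by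
    rw [← sum_coeff_single b, Finsupp.sum, map_sum]
    refine sum_mem fun s hs ↦ ?_
    have hk : v (j p)⁻¹ * φ (single p (b.coeff s)) ∈ K :=
      ⟨single p 1, single_mem_supportedInSubgroup F hp 1, by simp, single p (b.coeff s),
        single_mem_supportedInSubgroup F hp _, by
          rw [← hv, ← mul_assoc, ← map_mul, mul_inv_cancel, map_one, one_mul]⟩
    have : φ (single s (b.coeff s)) = (⟨_, hk⟩ : K) • v (j s) := by
      rw [hsmul, mul_assoc, hv, ← map_mul φ, single_mul_single, mul_one,
        ← one_mul (b.coeff s), ← single_mul_single, map_mul φ, ← hv, ← mul_assoc, ← map_mul v,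
        inv_mul_cancel, map_one, one_mul, one_mul]
    rw [this]
    exact Subalgebra.smul_mem _ (Algebra.subset_adjoin
      (Set.mem_image_of_mem v (Set.mem_image_of_mem j hs))) _
  obtain ⟨t, ht, κ, hκ, hbt⟩ := exists_mul_eq_algebraMap_of_closure_subset_span (hW.image v)
    hspan hbA (hQ.isUnit b hb).mem_nonZeroDivisors
  have htL : t ∈ L := by
    clear hbt
    induction ht using Algebra.adjoin_induction with
    | mem x hx =>
      rw [Set.mem_singleton_iff.mp hx]
      exact hQ.map_mem_fractionSubring hC hC0 le_top hne trivial
    | algebraMap k => exact hQ.fractionSubring_mono hC hC0 le_top hne k.2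
    | add x y _ _ hx hy => exact L.add_mem hx hy
    | mul x y _ _ hx hy => exact L.mul_mem hx hy
  obtain ⟨c, hc, hc0, r, -, hr⟩ := htL
  obtain ⟨c', hc', hc0', e, he, hce⟩ := κ.2
  have he0 : e ≠ 0 := by
    rintro rfl
    rw [map_zero, (hQ.isUnit c' (hC0 c' hc' hc0')).mul_right_eq_zero] at hce
    exact hκ (Subtype.ext hce)
  have hbr : b * (r * c') = c * e := by
    apply hQ.inj
    have hcc := Subring.mem_center_iff.mp (hQ.map_mem_center (hC c hc))
    have hcc' := Subring.mem_center_iff.mp (hQ.map_mem_center (hC c' hc'))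
    change φ b * t = κ at hbt
    rw [map_mul, map_mul, map_mul, ← hr, ← hce, ← hbt, mul_assoc (φ c) t, hcc' t,
      ← mul_assoc (φ b) (φ c), hcc (φ b), mul_assoc, ← mul_assoc (φ b) (φ c'), hcc' (φ b),
      mul_assoc (φ c')]
  refine ⟨r * c', hbr ▸ C.mul_mem hc he, ?_⟩
  rw [hbr]
  exact fun h0 ↦ he0 ((hC0 c hc hc0).1 _ h0)

end

end IsClassicalRightRingOfFractions

/-- If `S` is a cancellative semigroup and the semigroup algebra `F[S]` has a classical
right ring of fractions `Q` which is centrally essential, then `F[S]` is centrally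
essential. -/
theorem stmt4 (F : Type*) [Field F] (S : Type*) [Semigroup S] [IsCancelMul S]
    (Q : Type*) [Ring Q] (φ : MonoidAlgebra F S →ₙ+* Q)
    (hQ : IsClassicalRightRingOfFractions (MonoidAlgebra F S) Q φ)
    (h : IsCentrallyEssential Q) :
    IsCentrallyEssential (MonoidAlgebra F S) := by
  intro a ha
  have hne : a ≠ 0 := by
    rintro rfl
    exact ha (Set.zero_mem_center)
  have : Nonempty S := by
    by_contra hS
    rw [not_nonempty_iff] at hS
    exact hne (by ext s; exact hS.elim s)
  have : Nontrivial Q := ⟨φ a, 0, fun h0 ↦ hne (hQ.inj (h0.trans (map_zero φ).symm))⟩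
  obtain ⟨G, j, hj, hjφ, hG⟩ := hQ.exists_fraction_group
  obtain ⟨T, hT, hTu, hTpow⟩ := exists_uniqueProds_subgroup_center G
  obtain ⟨x, y, hx, hy, hx0, hy0, hxy⟩ := h (φ a) fun hφ ↦ ha (hQ.mem_center_of_map hφ)
  obtain ⟨a', b, hb, hab⟩ := hQ.num_denom x
  obtain ⟨r, hr, hr0⟩ := hQ.exists_mul_mem_supportedInSubgroup h hj hjφ hG hT hTpow hb
  have hc := hQ.map_mem_center (MonoidAlgebra.mem_center_of_mem_supportedInSubgroup hj hT hr)
  have hu := hQ.isUnit _ (MonoidAlgebra.isNonZeroDivisor_of_mem_supportedInSubgroup hj hT hr hr0)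
  have h1 : φ (a' * r) = x * φ (b * r) := by
    rw [map_mul, map_mul, ← hab, mul_assoc]
  have h2 : φ (a * (a' * r)) = y * φ (b * r) := by
    rw [map_mul, h1, ← mul_assoc, hxy]
  refine ⟨a' * r, a * (a' * r), hQ.mem_center_of_map ?_, hQ.mem_center_of_map ?_, ?_, ?_, rfl⟩
  · rw [h1]; exact Subring.mul_mem _ hx hc
  · rw [h2]; exact Subring.mul_mem _ hy hc
  · intro h0
    rw [h0, map_zero] at h1
    exact hx0 (hu.mul_left_eq_zero.mp h1.symm)
  · intro h0
    rw [h0, map_zero] at h2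
    exact hy0 (hu.mul_left_eq_zero.mp h2.symm)
end

section
/- Let F be a field and let S be a cancellative semigroup such that the semigroup algebra FS is a centrally essential ring. Then for every non-zero-divisor b ∈ FS, there exists a non-zero-divisor z ∈ FS such that bz ∈ Z(FS). -/
theorem charP_of_prime_of_cast_eq_zero {R : Type*} [NonAssocRing R] [Nontrivial R] {p : ℕ}
    (hp : p.Prime) (h : (p : R) = 0) : CharP R p :=
  CharP.ringChar_of_prime_eq_zero hp h ▸ ringChar.charP R

theorem exists_pow_mem_center_of_commutator_mem {R : Type*} [Ring R] {p : ℕ} (hp : p.Prime)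
    (hpR : (p : R) = 0) {J : Ideal (Subring.center R)} (hJ : IsNilpotent J) {b : R}
    (hb : ∀ r, b * r - r * b ∈ J • (⊤ : Submodule (Subring.center R) R)) :
    ∃ k, b ^ p ^ k ∈ Subring.center R := by
  rcases subsingleton_or_nontrivial R with hR | hR
  · exact ⟨0, Subring.mem_center_iff.2 fun _ => Subsingleton.elim _ _⟩
  obtain ⟨n, hn⟩ := hJ
  set L := LinearMap.mulLeft (Subring.center R) b
  set M := LinearMap.mulRight (Subring.center R) b
  have hpow : ∀ j, Submodule.map ((L - M) ^ j) ⊤ ≤ J ^ j • ⊤ := by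
    intro j
    induction j with
    | zero => simp
    | succ j ih =>
      have hD : Submodule.map (L - M) ⊤ ≤ J • ⊤ := by
        rintro _ ⟨r, -, rfl⟩
        exact hb r
      rw [pow_succ', Module.End.mul_eq_comp, Submodule.map_comp, pow_succ, Submodule.mul_smul]
      refine (Submodule.map_mono ih).trans ?_
      rw [Submodule.map_smul'']
      exact Submodule.smul_mono le_rfl hD
  have hk : n ≤ p ^ n := (Nat.lt_pow_self hp.one_lt).le
  have : Fact p.Prime := ⟨hp⟩
  have : CharP (Module.End (Subring.center R) R) p := by
    refine charP_of_prime_of_cast_eq_zero hp (LinearMap.ext fun r => ?_)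
    rw [← nsmul_one, LinearMap.smul_apply, Module.End.one_apply, nsmul_eq_mul, hpR, zero_mul,
      LinearMap.zero_apply]
  refine ⟨n, Subring.mem_center_iff.2 fun r => ?_⟩
  have hz : ((L - M) ^ p ^ n) r = 0 := by
    have := (hpow (p ^ n)) ⟨r, trivial, rfl⟩
    rw [← Nat.add_sub_cancel' hk, pow_add J, hn] at this
    simpa [Nat.add_sub_cancel' hk] using this
  rw [sub_pow_char_pow_of_commute p n (LinearMap.commute_mulLeft_right b b),
    LinearMap.pow_mulLeft, LinearMap.pow_mulRight] at hz
  exact (sub_eq_zero.1 hz).symm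

theorem commutator_mul_center {H : Type*} [Group H] (c h : H) {z w : H}
    (hz : z ∈ Subgroup.center H) (hw : w ∈ Subgroup.center H) :
    c * z * (h * w) * (c * z)⁻¹ * (h * w)⁻¹ = c * h * c⁻¹ * h⁻¹ := by
  rw [Subgroup.mem_center_iff] at hz hw
  calc _ = c * (z * h) * w * z⁻¹ * c⁻¹ * w⁻¹ * h⁻¹ := by group
    _ = c * h * (z * w) * z⁻¹ * c⁻¹ * w⁻¹ * h⁻¹ := by rw [← hz h]; group
    _ = c * h * (w * c⁻¹) * w⁻¹ * h⁻¹ := by rw [hw z]; group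
    _ = _ := by rw [← hw]; group

theorem map_pow_commutator_eq_one {H R : Type*} [Group H] [Ring R] (ρ : H →* R) {c h : H} {n : ℕ}
    (hcomm : ρ (c * h * c⁻¹ * h⁻¹) ∈ Subring.center R) (hn : c ^ n ∈ Subgroup.center H) :
    ρ (c * h * c⁻¹ * h⁻¹) ^ n = 1 := by
  set ζ := ρ (c * h * c⁻¹ * h⁻¹) with hζ
  have key : ∀ m : ℕ, ρ (c ^ m * h) = ζ ^ m * ρ (h * c ^ m) := by
    intro m
    induction m with
    | zero => simp
    | succ m ih =>
      calc ρ (c ^ (m + 1) * h) = ρ c * ρ (c ^ m * h) := by rw [← map_mul, pow_succ', mul_assoc]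
        _ = ζ ^ m * ρ c * ρ (h * c ^ m) := by
          rw [ih, ← mul_assoc, Subring.mem_center_iff.1 (pow_mem hcomm m)]
        _ = ζ ^ m * ρ ((c * h * c⁻¹ * h⁻¹) * (h * c ^ (m + 1))) := by
          rw [mul_assoc, ← map_mul]
          congr 2
          rw [pow_succ']
          group
        _ = _ := by rw [map_mul, ← hζ, ← mul_assoc, ← pow_succ]
  have hkey := key n
  rw [← Subgroup.mem_center_iff.1 hn h] at hkey
  calc ζ ^ n = ζ ^ n * ρ (h * c ^ n) * ρ (h * c ^ n)⁻¹ := by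
        rw [mul_assoc, ← map_mul, mul_inv_cancel, map_one, mul_one]
    _ = 1 := by rw [← hkey, ← map_mul, mul_inv_cancel, map_one]

theorem mem_center_of_adjoin_eq_top {F R : Type*} [CommSemiring F] [Ring R] [Algebra F R]
    {s : Set R} (hs : Algebra.adjoin F s = ⊤) {x : R} (hx : ∀ y ∈ s, y * x = x * y) :
    x ∈ Subring.center R := by
  have hle : Algebra.adjoin F s ≤ Subalgebra.centralizer F {x} := Algebra.adjoin_le fun y hy => by
    rw [SetLike.mem_coe, Subalgebra.mem_centralizer_iff]
    rintro _ rfl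
    exact (hx y hy).symm
  rw [hs] at hle
  exact Subring.mem_center_iff.2 fun y =>
    ((Subalgebra.mem_centralizer_iff F).1 (hle (Algebra.mem_top (x := y))) x rfl).symm

/-- Descending induction along the upper central series. -/
theorem exists_pow_mem_center_of_upperCentralSeries {F H : Type*} [Field F] [Group H] {p : ℕ}
    (hp : p.Prime) (hpF : (p : F) = 0) [Finite (H ⧸ Subgroup.center H)]
    (hH : IsPGroup p (H ⧸ Subgroup.center H)) (j : ℕ) :
    ∀ (n : ℕ), Subgroup.upperCentralSeries H (n + j) = ⊤ →
    ∀ {R : Type*} [Ring R] [Algebra F R] (ρ : H →* R), Algebra.adjoin F (Set.range ρ) = ⊤ →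
      (∀ h ∈ Subgroup.upperCentralSeries H n, ρ h ∈ Subring.center R) →
      ∀ b : R, ∃ k, b ^ p ^ k ∈ Subring.center R := by
  induction j with
  | zero =>
    intro n hn R _ _ ρ hρ hc b
    rw [add_zero] at hn
    refine ⟨0, ?_⟩
    have hle : Algebra.adjoin F (Set.range ρ) ≤ Subalgebra.center F R := by
      refine Algebra.adjoin_le ?_
      rintro _ ⟨h, rfl⟩
      exact hc h (hn ▸ trivial)
    rw [hρ] at hle
    exact hle trivial
  | succ j ih =>
    intro n hn R _ _ ρ hρ hc b
    have hpR : (p : R) = 0 := by rw [← map_natCast (algebraMap F R), hpF, map_zero]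
    have hcomm : ∀ c ∈ Subgroup.upperCentralSeries H (n + 1), ∀ h : H,
        ρ (c * h * c⁻¹ * h⁻¹) ∈ Subring.center R :=
      fun c hc' h => hc _ (Subgroup.mem_upperCentralSeries_succ_iff.1 hc' h)
    set X : Set (Subring.center R) :=
      {x | ∃ c ∈ Subgroup.upperCentralSeries H (n + 1), ∃ h : H,
        (x : R) = ρ (c * h * c⁻¹ * h⁻¹) - 1}
    have hXfin : X.Finite := by
      refine Set.Finite.of_finite_image (f := Subtype.val) ?_ Subtype.val_injective.injOn
      refine (Set.finite_range fun x : (H ⧸ Subgroup.center H) × (H ⧸ Subgroup.center H) =>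
        ρ (x.1.out * x.2.out * x.1.out⁻¹ * x.2.out⁻¹) - 1).subset ?_
      rintro _ ⟨x, ⟨c, -, h, hx⟩, rfl⟩
      refine ⟨(c, h), ?_⟩
      obtain ⟨⟨z, hz⟩, hcz⟩ := QuotientGroup.mk_out_eq_mul (Subgroup.center H) c
      obtain ⟨⟨w, hw⟩, hhw⟩ := QuotientGroup.mk_out_eq_mul (Subgroup.center H) h
      simp only [hx, hcz, hhw, commutator_mul_center c h hz hw]
    have hXnil : ∀ x ∈ X, IsNilpotent x := by
      rintro x ⟨c, hc', h, hx⟩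
      obtain ⟨k, hk⟩ := hH (c : H ⧸ Subgroup.center H)
      rw [← QuotientGroup.mk_pow, QuotientGroup.eq_one_iff] at hk
      rcases subsingleton_or_nontrivial R with hR | hR
      · exact ⟨1, Subsingleton.elim _ _⟩
      have : Fact p.Prime := ⟨hp⟩
      have : CharP R p := charP_of_prime_of_cast_eq_zero hp hpR
      refine ⟨p ^ k, Subtype.ext ?_⟩
      rw [SubmonoidClass.coe_pow, hx, sub_pow_char_pow_of_commute p k (Commute.one_right _),
        one_pow, map_pow_commutator_eq_one ρ (hcomm c hc' h) hk, sub_self]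
      rfl
    set J := Ideal.span X
    have hJ : IsNilpotent J := by
      rw [Ideal.FG.isNilpotent_iff_le_nilradical ⟨hXfin.toFinset, by simp [J]⟩]
      exact Ideal.span_le.2 hXnil
    set I : Ideal R := Ideal.span ((↑) '' X)
    have hI : I.IsTwoSided := by
      refine ⟨fun {x} r hx => ?_⟩
      refine Submodule.span_induction ?_ (by simp) (fun x y _ _ hx hy => ?_)
        (fun s x _ hx => ?_) hx
      · rintro _ ⟨x, hx, rfl⟩
        rw [← Subring.mem_center_iff.1 x.2 r]
        exact I.mul_mem_left r (Ideal.subset_span ⟨x, hx, rfl⟩)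
      · rw [add_mul]
        exact I.add_mem hx hy
      · rw [smul_eq_mul, mul_assoc]
        exact I.mul_mem_left s hx
    have hIJ : ∀ x ∈ I, x ∈ J • (⊤ : Submodule (Subring.center R) R) := by
      intro x hx
      refine Submodule.span_induction ?_ (Submodule.zero_mem _)
        (fun x y _ _ hx hy => Submodule.add_mem _ hx hy) (fun s x _ hx => ?_) hx
      · rintro _ ⟨x, hx, rfl⟩
        have := Submodule.smul_mem_smul (Ideal.subset_span hx : x ∈ J)
          (Submodule.mem_top (R := Subring.center R) (x := (1 : R)))
        rwa [Subring.smul_def, smul_eq_mul, mul_one] at this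
      · have := Submodule.mem_map_of_mem (f := LinearMap.mulLeft (Subring.center R) s) hx
        rw [Submodule.map_smul''] at this
        exact Submodule.smul_mono le_rfl le_top this
    set π : R →ₐ[F] R ⧸ I := Ideal.Quotient.mkₐ F I
    have hadj : Algebra.adjoin F (Set.range ((π : R →* R ⧸ I).comp ρ)) = ⊤ := by
      rw [MonoidHom.coe_comp, Set.range_comp]
      change Algebra.adjoin F (π '' Set.range ρ) = ⊤
      rw [← AlgHom.map_adjoin, hρ, Algebra.map_top, AlgHom.range_eq_top]
      exact Ideal.Quotient.mkₐ_surjective F I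
    obtain ⟨k, hk⟩ := ih (n + 1) (by rw [← hn]; congr 1; ring) ((π : R →* R ⧸ I).comp ρ) hadj
      (fun c hc' => mem_center_of_adjoin_eq_top hadj (by
        rintro _ ⟨h, rfl⟩
        change π (ρ h) * π (ρ c) = π (ρ c) * π (ρ h)
        rw [← map_mul, ← map_mul, ← map_mul, ← map_mul, eq_comm]
        refine Ideal.Quotient.eq.2 ?_
        rw [map_mul ρ c h]
        have : ρ c * ρ h - ρ (h * c) = ρ (h * c) * (ρ (c * h * c⁻¹ * h⁻¹) - 1) := by
          rw [mul_sub, mul_one, Subring.mem_center_iff.1 (hcomm c hc' h), ← map_mul, ← map_mul]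
          group
        rw [this]
        exact I.mul_mem_left _ (Ideal.subset_span ⟨⟨_, sub_mem (hcomm c hc' h) (one_mem _)⟩,
          ⟨c, hc', h, rfl⟩, rfl⟩)))
      (π b)
    obtain ⟨l, hl⟩ := exists_pow_mem_center_of_commutator_mem hp hpR hJ (b := b ^ p ^ k) (by
      intro r
      refine hIJ _ ?_
      rw [← Ideal.Quotient.mk_eq_mk_iff_sub_mem]
      rw [map_mul, map_mul, map_pow]
      exact (Subring.mem_center_iff.1 hk (π r)).symm)
    exact ⟨k + l, by rwa [pow_add, pow_mul]⟩

theorem MonoidAlgebra.adjoin_range_of_eq_top (F H : Type*) [CommSemiring F] [Monoid H] :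
    Algebra.adjoin F (Set.range (MonoidAlgebra.of F H)) = ⊤ :=
  eq_top_iff.2 fun b _ => Algebra.adjoin_mono (Set.image_subset_range _ _) (mem_adjoin_support b)

theorem MonoidAlgebra.exists_pow_mem_center {F H : Type*} [Field F] [Group H] {p : ℕ}
    (hp : p.Prime) (hpF : (p : F) = 0) [Finite (H ⧸ Subgroup.center H)]
    (hH : IsPGroup p (H ⧸ Subgroup.center H)) (b : MonoidAlgebra F H) :
    ∃ k, b ^ p ^ k ∈ Subring.center (MonoidAlgebra F H) := by
  have : Fact p.Prime := ⟨hp⟩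
  have : Group.IsNilpotent H := Group.of_quotient_center_nilpotent hH.isNilpotent
  obtain ⟨n, hn⟩ := Group.IsNilpotent.nilpotent H
  refine exists_pow_mem_center_of_upperCentralSeries hp hpF hH n 0 (by rwa [zero_add])
    (MonoidAlgebra.of F H) ?_ ?_ b
  · exact adjoin_range_of_eq_top F H
  · intro h hh
    rw [Subgroup.upperCentralSeries_zero, Subgroup.mem_bot] at hh
    rw [hh, map_one]
    exact one_mem _

theorem MonoidAlgebra.commute_of {F G : Type*} [CommSemiring F] [Monoid G] {b : MonoidAlgebra F G}
    {c : G} (hc : ∀ e ∈ b.coeff.support, e * c = c * e) : Commute b (MonoidAlgebra.of F G c) := by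
  have hle : Algebra.adjoin F (MonoidAlgebra.of F G '' b.coeff.support) ≤
      Subalgebra.centralizer F {MonoidAlgebra.of F G c} := Algebra.adjoin_le (by
    rintro _ ⟨e, he, rfl⟩
    rw [SetLike.mem_coe, Subalgebra.mem_centralizer_iff]
    rintro _ rfl
    rw [← map_mul, ← map_mul, hc e he])
  exact ((Subalgebra.mem_centralizer_iff F).1 (hle (mem_adjoin_support b)) _ rfl).symm

theorem Subgroup.finite_quotient_center_closure {G : Type*} [Group G] {E : Set G} (hE : E.Finite)
    (hfc : ∀ g : G, (Subgroup.centralizer {g}).FiniteIndex) :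
    Finite (Subgroup.closure E ⧸ Subgroup.center (Subgroup.closure E)) := by
  have : Finite E := hE
  have h1 : (⨅ e : E, (Subgroup.centralizer {(e : G)}).subgroupOf (closure E)).FiniteIndex :=
    Subgroup.finiteIndex_iInf fun e => inferInstance
  have h2 : (⨅ e : E, (Subgroup.centralizer {(e : G)}).subgroupOf (closure E)) ≤
      Subgroup.center (Subgroup.closure E) := by
    intro x hx
    rw [Subgroup.mem_center_iff]
    have : closure E ≤ Subgroup.centralizer {(x : G)} := by
      rw [Subgroup.closure_le]
      intro e he
      have hxe := Subgroup.mem_iInf.1 hx ⟨e, he⟩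
      rw [Subgroup.mem_subgroupOf, Subgroup.mem_centralizer_singleton_iff] at hxe
      exact Subgroup.mem_centralizer_singleton_iff.2 hxe.symm
    intro y
    exact Subtype.ext (Subgroup.mem_centralizer_singleton_iff.1 (this y.2))
  have := Subgroup.finiteIndex_of_le h2
  infer_instance

theorem MonoidAlgebra.exists_pow_mem_center_of_finiteIndex_centralizer {F G : Type*} [Field F]
    [Group G] (hfc : ∀ g : G, (Subgroup.centralizer {g}).FiniteIndex)
    (hroot : ∀ (u r : G) (m : ℕ), (m : F) ≠ 0 → Commute (u ^ m) r → Commute u r)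
    (b : MonoidAlgebra F G) : ∃ n, 0 < n ∧ b ^ n ∈ Subring.center (MonoidAlgebra F G) := by
  obtain ⟨p, hpF⟩ := ExpChar.exists F
  rcases hpF with _ | ⟨hp⟩
  · have hG : ∀ u r : G, Commute u r := by
      intro u r
      obtain ⟨n, hn, -, hu⟩ := Subgroup.exists_pow_mem_of_index_ne_zero (hfc r).index_ne_zero u
      exact hroot u r n (Nat.cast_ne_zero.2 hn.ne') (Subgroup.mem_centralizer_singleton_iff.1 hu)
    refine ⟨1, one_pos, mem_center_of_adjoin_eq_top (adjoin_range_of_eq_top F G) ?_⟩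
    rintro _ ⟨g, rfl⟩
    rw [pow_one]
    exact (commute_of fun e _ => hG e g).symm
  have hpF : (p : F) = 0 := CharP.cast_eq_zero F p
  set C : Subgroup G := ⨅ e : b.coeff.support, Subgroup.centralizer {(e : G)}
  have hCfin : C.FiniteIndex := Subgroup.finiteIndex_iInf fun e => hfc e
  have : Finite (G ⧸ C) := Subgroup.finite_quotient_of_finiteIndex
  set E : Set G := b.coeff.support ∪ Set.range (Quotient.out : G ⧸ C → G)
  set H := Subgroup.closure E
  have hEH : E ⊆ H := Subgroup.subset_closure
  have hEfin : E.Finite := b.coeff.support.finite_toSet.union (Set.finite_range _)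
  have hHfin : Finite (H ⧸ Subgroup.center H) := Subgroup.finite_quotient_center_closure hEfin hfc
  have hHp : IsPGroup p (H ⧸ Subgroup.center H) := by
    rintro ⟨h⟩
    obtain ⟨n, hn, -, hh⟩ := Subgroup.exists_pow_mem_of_index_ne_zero
      (Subgroup.index_ne_zero_of_finite (H := Subgroup.center H)) h
    obtain ⟨a, m, hm, rfl⟩ := Nat.exists_eq_pow_mul_and_not_dvd hn.ne' p hp.ne_one
    refine ⟨a, (QuotientGroup.eq_one_iff (N := Subgroup.center H) (h ^ p ^ a)).2 ?_⟩
    rw [Subgroup.mem_center_iff] at hh ⊢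
    intro r
    refine Subtype.ext (Commute.symm (hroot _ _ m ?_ ?_))
    · rwa [Ne, CharP.cast_eq_zero_iff F p]
    · have := congrArg Subtype.val (hh r)
      rw [pow_mul] at this
      exact this.symm
  obtain ⟨b', hb'⟩ : ∃ b' : MonoidAlgebra F H, mapDomainRingHom F H.subtype b' = b :=
    ⟨comapDomain H.subtype H.subtype_injective b, mapDomain_comapDomain (by
      intro e he
      exact ⟨⟨e, hEH (Or.inl he)⟩, rfl⟩) _⟩
  obtain ⟨k, hk⟩ := MonoidAlgebra.exists_pow_mem_center hp hpF hHp b'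
  refine ⟨p ^ k, pow_pos hp.pos k, mem_center_of_adjoin_eq_top (adjoin_range_of_eq_top F G) ?_⟩
  rintro _ ⟨g, rfl⟩
  obtain ⟨⟨c, hc⟩, hg⟩ := QuotientGroup.mk_out_eq_mul C g
  have hbc : Commute b (of F G c⁻¹) := commute_of fun e he =>
    (Subgroup.mem_centralizer_singleton_iff.1 (Subgroup.mem_iInf.1 (C.inv_mem hc) ⟨e, he⟩)).symm
  have hbt : Commute (b ^ p ^ k) (of F G (g : G ⧸ C).out) := by
    have := congrArg (mapDomainRingHom F H.subtype)
      (Subring.mem_center_iff.1 hk (of F H ⟨(g : G ⧸ C).out, hEH (Or.inr ⟨_, rfl⟩)⟩))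
    simp only [map_mul, map_pow, hb'] at this
    simpa [Commute, SemiconjBy] using this.symm
  have hgc : g = (g : G ⧸ C).out * c⁻¹ := by rw [hg, mul_inv_cancel_right]
  rw [hgc, map_mul]
  exact (hbt.mul_right (hbc.pow_left _)).symm.eq

theorem Subgroup.exists_pow_mem_center {G : Type*} [Group G]
    (hfc : ∀ g : G, (Subgroup.centralizer {g}).FiniteIndex) (u : G) :
    ∃ n, 0 < n ∧ u ^ n ∈ Subgroup.center G := by
  set C := Subgroup.centralizer {u}
  have := hfc u
  have : Finite (G ⧸ C) := Subgroup.finite_quotient_of_finiteIndex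
  have := Fintype.ofFinite (G ⧸ C)
  choose n hn _ hu using fun q : G ⧸ C =>
    Subgroup.exists_pow_mem_of_index_ne_zero (hfc q.out).index_ne_zero u
  refine ⟨∏ q, n q, Finset.prod_pos fun q _ => hn q, Subgroup.mem_center_iff.2 fun g => ?_⟩
  obtain ⟨⟨c, hc⟩, hg⟩ := QuotientGroup.mk_out_eq_mul C g
  obtain ⟨l, hl⟩ := Finset.dvd_prod_of_mem n (Finset.mem_univ (g : G ⧸ C))
  have h1 : Commute (u ^ ∏ q, n q) (g : G ⧸ C).out := by
    have h := Subgroup.mem_centralizer_singleton_iff.1 (hu (g : G ⧸ C))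
    rw [hl, pow_mul]
    exact Commute.pow_left h l
  have h2 : Commute (u ^ ∏ q, n q) c⁻¹ :=
    Commute.pow_left (Subgroup.mem_centralizer_singleton_iff.1 (C.inv_mem hc)).symm _
  have hgc : g = (g : G ⧸ C).out * c⁻¹ := by rw [hg, mul_inv_cancel_right]
  rw [hgc]
  exact (h1.mul_right h2).symm.eq

theorem MonoidAlgebra.finiteIndex_centralizer_of_mem_support {F G : Type*} [Field F] [Group G]
    {y : MonoidAlgebra F G} (hy : y ∈ Subring.center (MonoidAlgebra F G)) {w : G}
    (hw : w ∈ y.coeff.support) : (Subgroup.centralizer {w}).FiniteIndex := by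
  have hconj : ∀ g : G, g * w * g⁻¹ ∈ y.coeff.support := by
    intro g
    have := congrArg (fun z => z.coeff (g * w)) (Subring.mem_center_iff.1 hy (single g 1))
    simp only [coeff_single_mul_apply, coeff_mul_single_apply, inv_mul_cancel_left, one_mul,
      mul_one] at this
    rwa [Finsupp.mem_support_iff, ← this, ← Finsupp.mem_support_iff]
  have : Finite (G ⧸ Subgroup.centralizer {w}) := by
    refine Finite.of_injective
      (fun q => (⟨q.out * w * q.out⁻¹, hconj q.out⟩ : y.coeff.support)) fun q q' hqq => ?_
    have h : q.out * w * q.out⁻¹ = q'.out * w * q'.out⁻¹ := congrArg Subtype.val hqq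
    rw [← Quotient.out_eq' q, ← Quotient.out_eq' q']
    refine QuotientGroup.eq.2 (Subgroup.mem_centralizer_singleton_iff.2 ?_)
    calc q.out⁻¹ * q'.out * w = q.out⁻¹ * (q'.out * w * q'.out⁻¹) * q'.out := by group
      _ = w * (q.out⁻¹ * q'.out) := by rw [← h]; group
  exact Subgroup.finiteIndex_of_finite_quotient

theorem mul_eq_zero_of_mem_center_of_commute_pow {R : Type*} [Ring R] (u : Rˣ) {r x : R} {m : ℕ}
    (hm : ∀ v : R, m • v = 0 → v = 0) (hur : Commute ((u : R) ^ m) r)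
    (hx : x ∈ Subring.center R)
    (hax : ((u : R) ^ m * r - ↑u⁻¹ * ((u : R) ^ m * r) * u) * x ∈ Subring.center R) :
    ((u : R) ^ m * r - ↑u⁻¹ * ((u : R) ^ m * r) * u) * x = 0 := by
  set c := (u : R) ^ m * r with hc
  set a := c - ↑u⁻¹ * c * u with ha
  let d : ℕ → R := fun i => ↑(u ^ i)⁻¹ * c * ↑(u ^ i)
  have hterm : ∀ i, (d i - d (i + 1)) * x = a * x := by
    intro i
    have h1 : d i - d (i + 1) = ↑(u ^ i)⁻¹ * a * ↑(u ^ i) := by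
      simp only [d, ha, mul_sub, sub_mul, pow_succ', mul_inv_rev, Units.val_mul, mul_assoc]
    rw [h1, mul_assoc, Subring.mem_center_iff.1 hx, mul_assoc, ← mul_assoc a x,
      ← Subring.mem_center_iff.1 hax, ← mul_assoc, Units.inv_mul, one_mul]
  have hd : d m = d 0 := by
    have : c = r * ↑(u ^ m) := by rw [hc, hur.eq, Units.val_pow_eq_pow_val]
    simp only [d, pow_zero, inv_one, Units.val_one, one_mul, mul_one]
    rw [hc, ← Units.val_pow_eq_pow_val, Units.inv_mul_cancel_left, ← this, hc,
      Units.val_pow_eq_pow_val]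
  have hsum := Finset.sum_range_sub' d m
  rw [hd, sub_self] at hsum
  apply hm
  calc m • (a * x) = ∑ i ∈ Finset.range m, (d i - d (i + 1)) * x := by simp [hterm]
    _ = 0 := by rw [← Finset.sum_mul, hsum, zero_mul]

theorem exists_group_of_ore.{u} {S : Type u} [Semigroup S] [IsCancelMul S] [Nonempty S]
    (hore : ∀ s t : S, ∃ a b, a * t = b * s) :
    ∃ (G : Type u) (_ : Group G) (φ : S →ₙ* G),
      Function.Injective φ ∧ ∀ g, ∃ a b, φ a * g = φ b := by
  obtain ⟨e⟩ := ‹Nonempty S›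
  have hcoe : ∀ r : WithOne S, ∃ s : S, (e : WithOne S) * r = s := by
    intro r
    induction r with
    | one => exact ⟨e, mul_one _⟩
    | coe s => exact ⟨e * s, (WithOne.coe_mul e s).symm⟩
  have hore' : ∀ r : WithOne S, ∀ s : (⊤ : Submonoid (WithOne S)),
      ∃ (n : WithOne S) (d : (⊤ : Submonoid (WithOne S))), d * r = n * s := by
    rintro r ⟨s, hs⟩
    induction r with
    | one => exact ⟨1, ⟨s, hs⟩, by simp⟩
    | coe r =>
      induction s with
      | one => exact ⟨r, 1, by simp⟩
      | coe s =>
        obtain ⟨a, b, hab⟩ := hore s r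
        exact ⟨b, ⟨a, trivial⟩, by simp only [← WithOne.coe_mul, hab]⟩
  choose num den hnd using hore'
  have : OreLocalization.OreSet (⊤ : Submonoid (WithOne S)) :=
    { ore_right_cancel := by
        rintro r₁ r₂ ⟨s, hs⟩ h
        refine ⟨⟨e, trivial⟩, ?_⟩
        induction s with
        | one => rw [show r₁ = r₂ by simpa using h]
        | coe s =>
          obtain ⟨s₁, h₁⟩ := hcoe r₁
          obtain ⟨s₂, h₂⟩ := hcoe r₂
          have := congrArg ((e : WithOne S) * ·) h
          simp only [← mul_assoc, h₁, h₂, ← WithOne.coe_mul, WithOne.coe_inj] at this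
          simp only [h₁, h₂, mul_right_cancel this]
      oreNum := num
      oreDenom := den
      ore_eq := hnd }
  let ν : WithOne S →* OreLocalization (⊤ : Submonoid (WithOne S)) (WithOne S) :=
    OreLocalization.numeratorHom
  have hν : ∀ g, ∃ s r : WithOne S, ν s * g = ν r := by
    intro g
    induction g using OreLocalization.ind with
    | _ r s =>
      exact ⟨s, r, OreLocalization.mul_cancel⟩
  have hunit : ∀ g : OreLocalization (⊤ : Submonoid (WithOne S)) (WithOne S), IsUnit g := by
    intro g
    obtain ⟨s, r, h⟩ := hν g
    have hs : IsUnit (ν s) :=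
      OreLocalization.numerator_isUnit
        (⟨s, trivial⟩ : (⊤ : Submonoid (WithOne S)))
    have hr : IsUnit (ν r) :=
      OreLocalization.numerator_isUnit
        (⟨r, trivial⟩ : (⊤ : Submonoid (WithOne S)))
    rw [← h] at hr
    exact (Units.isUnit_units_mul hs.unit g).1 hr
  refine ⟨_, groupOfIsUnit hunit, ν.toMulHom.comp WithOne.coeMulHom, ?_, ?_⟩
  · intro a b hab
    obtain ⟨⟨u, hu⟩, v, huv, huv'⟩ := OreLocalization.oreDiv_eq_iff.1 hab
    simp only [OneMemClass.coe_one, mul_one] at huv'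
    subst huv'
    obtain ⟨s, hs⟩ := hcoe u
    have huv'' : u * (b : WithOne S) = u * (a : WithOne S) := huv
    have := congrArg ((e : WithOne S) * ·) huv''
    simp only [← mul_assoc, hs, ← WithOne.coe_mul, WithOne.coe_inj] at this
    exact (mul_left_cancel this).symm
  · intro g
    obtain ⟨s, r, h⟩ := hν g
    obtain ⟨a, ha⟩ := hcoe s
    obtain ⟨b, hb⟩ := hcoe r
    refine ⟨a, b, ?_⟩
    change ν a * g = ν b
    rw [← ha, ← hb, map_mul, map_mul, mul_assoc, h]

theorem MonoidAlgebra.exists_mul_eq_mul_of_mem_center {F S : Type*} [Field F] [Semigroup S]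
    [IsCancelMul S] {y : MonoidAlgebra F S} (hy : y ∈ Set.center (MonoidAlgebra F S)) {w : S}
    (hw : w ∈ y.coeff.support) (t : S) : ∃ v, t * w = v * t := by
  have hc := congrArg (fun z => z.coeff (t * w)) (Semigroup.mem_center_iff.1 hy (single t 1))
  by_contra! hv
  have h0 := coeff_mul_single_of_forall_mul_ne (1 : F) y fun v => (hv v).symm
  have h1 := coeff_single_mul_eq_mul_coeff (x := y) (r := 1) (m := t) (m₁ := t * w) w (by simp)
  rw [one_mul] at h1
  exact Finsupp.mem_support_iff.1 hw (h1.symm.trans (hc.trans h0))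

theorem MonoidAlgebra.single_ne_zero_of_one {F S : Type*} [Field F] (s : S) :
    (single s 1 : MonoidAlgebra F S) ≠ 0 := fun h => by
  simpa using congrArg (fun z => z.coeff s) h

theorem IsCentrallyEssential.exists_single_mul_mem_center {F S : Type*} [Field F] [Semigroup S]
    (h : IsCentrallyEssential (MonoidAlgebra F S)) (s : S) :
    ∃ x ∈ Set.center (MonoidAlgebra F S), x ≠ 0 ∧
      MonoidAlgebra.single s 1 * x ∈ Set.center (MonoidAlgebra F S) := by
  by_cases hs : MonoidAlgebra.single s 1 ∈ Set.center (MonoidAlgebra F S)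
  · exact ⟨_, hs, MonoidAlgebra.single_ne_zero_of_one s, Set.mul_mem_center hs hs⟩
  · obtain ⟨x, y, hx, hy, hx0, -, rfl⟩ := h _ hs
    exact ⟨x, hx, hx0, hy⟩

theorem IsCentrallyEssential.exists_mul_eq_mul {F S : Type*} [Field F] [Semigroup S]
    [IsCancelMul S] (h : IsCentrallyEssential (MonoidAlgebra F S)) (s t : S) :
    ∃ a b, a * t = b * s := by
  obtain ⟨x, hx, hx0, hsx⟩ := h.exists_single_mul_mem_center s
  obtain ⟨τ, hτ⟩ := Finsupp.support_nonempty_iff.2 (MonoidAlgebra.coeff_eq_zero.not.2 hx0)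
  rw [Semigroup.mem_center_iff.1 hx] at hsx
  have hmem : τ * s ∈ (x * MonoidAlgebra.single s 1).coeff.support := by
    rw [Finsupp.mem_support_iff, MonoidAlgebra.coeff_mul_single_eq_coeff_mul τ (by simp), mul_one]
    exact Finsupp.mem_support_iff.1 hτ
  obtain ⟨v, hv⟩ := MonoidAlgebra.exists_mul_eq_mul_of_mem_center hsx hmem t
  exact ⟨v, t * τ, by rw [← hv, mul_assoc]⟩

section Fractions

variable {F S G : Type*} [Field F] [Semigroup S] [Group G] {φ : S →ₙ* G}

theorem MonoidAlgebra.mapDomain_mem_center (hφ : ∀ g, ∃ a b, φ a * g = φ b)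
    {y : MonoidAlgebra F S} (hy : y ∈ Set.center (MonoidAlgebra F S)) :
    mapDomain φ y ∈ Subring.center (MonoidAlgebra F G) := by
  have hS : ∀ t, of F G (φ t) * mapDomain φ y = mapDomain φ y * of F G (φ t) := by
    intro t
    have := congrArg (mapDomain φ) (Semigroup.mem_center_iff.1 hy (single t 1))
    rwa [mapDomain_mul, mapDomain_mul, mapDomain_single] at this
  refine mem_center_of_adjoin_eq_top (adjoin_range_of_eq_top F G) ?_
  rintro _ ⟨g, rfl⟩
  obtain ⟨a, b, hab⟩ := hφ g
  have hb := hS b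
  rw [← hab, map_mul, mul_assoc, ← mul_assoc _ (of F G (φ a)), ← hS a, mul_assoc] at hb
  have := congrArg (of F G (φ a)⁻¹ * ·) hb
  simpa only [← mul_assoc, ← map_mul, inv_mul_cancel, map_one, one_mul] using this

theorem MonoidAlgebra.exists_mapDomain_mul_mem_center (h : IsCentrallyEssential (MonoidAlgebra F S))
    (hinj : Function.Injective φ) (hφ : ∀ g, ∃ a b, φ a * g = φ b) (α : MonoidAlgebra F S)
    (hα : mapDomain φ α ∉ Subring.center (MonoidAlgebra F G)) :
    ∃ x ∈ Subring.center (MonoidAlgebra F G),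
      mapDomain φ α * x ∈ Subring.center (MonoidAlgebra F G) ∧ mapDomain φ α * x ≠ 0 := by
  obtain ⟨x, y, hx, hy, -, hy0, rfl⟩ := h α fun hc => hα (mapDomain_mem_center hφ hc)
  refine ⟨mapDomain φ x, mapDomain_mem_center hφ hx, ?_, ?_⟩
  · rw [← mapDomain_mul]
    exact mapDomain_mem_center hφ hy
  · rw [← mapDomain_mul]
    exact fun h0 => hy0 (mapDomain_injective hinj (h0.trans (mapDomain_zero _).symm))

theorem IsCentrallyEssential.finiteIndex_centralizer [IsCancelMul S]
    (h : IsCentrallyEssential (MonoidAlgebra F S))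
    (hinj : Function.Injective φ) (hφ : ∀ g, ∃ a b, φ a * g = φ b) (g : G) :
    (Subgroup.centralizer {g}).FiniteIndex := by
  have hS : ∀ s, (Subgroup.centralizer {φ s}).FiniteIndex := by
    intro s
    obtain ⟨x, hx, hx0, hsx⟩ := h.exists_single_mul_mem_center s
    obtain ⟨τ, hτ⟩ := Finsupp.support_nonempty_iff.2 (MonoidAlgebra.coeff_eq_zero.not.2 hx0)
    have hmem : ∀ {y : MonoidAlgebra F S} {w : S}, w ∈ y.coeff.support →
        φ w ∈ (MonoidAlgebra.mapDomain φ y).coeff.support := by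
      intro y w hw
      rw [Finsupp.mem_support_iff] at hw ⊢
      rwa [MonoidAlgebra.coeff_mapDomain, Finsupp.mapDomain_apply hinj]
    have h1 := MonoidAlgebra.finiteIndex_centralizer_of_mem_support
      (MonoidAlgebra.mapDomain_mem_center hφ hx) (hmem hτ)
    have h2 := MonoidAlgebra.finiteIndex_centralizer_of_mem_support
      (MonoidAlgebra.mapDomain_mem_center hφ hsx) (hmem (w := s * τ) (by
        rw [Finsupp.mem_support_iff, MonoidAlgebra.coeff_single_mul_eq_mul_coeff τ (by simp), one_mul]
        exact Finsupp.mem_support_iff.1 hτ))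
    refine Subgroup.finiteIndex_of_le (H := Subgroup.centralizer {φ τ} ⊓
      Subgroup.centralizer {φ (s * τ)}) fun u ⟨hu, hu'⟩ => ?_
    rw [Subgroup.mem_centralizer_singleton_iff]
    have hu := Subgroup.mem_centralizer_singleton_iff.1 hu
    have hu' := Subgroup.mem_centralizer_singleton_iff.1 hu'
    rw [map_mul, mul_assoc, ← hu, ← mul_assoc, ← mul_assoc] at hu'
    exact mul_right_cancel hu'
  obtain ⟨a, b, hab⟩ := hφ g
  have := hS a
  have := hS b
  refine Subgroup.finiteIndex_of_le (H := Subgroup.centralizer {φ a} ⊓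
      Subgroup.centralizer {φ b}) fun u ⟨hu, hu'⟩ => ?_
  have hu : Commute u (φ a) := Subgroup.mem_centralizer_singleton_iff.1 hu
  have hu' : Commute u (φ b) := Subgroup.mem_centralizer_singleton_iff.1 hu'
  rw [Subgroup.mem_centralizer_singleton_iff, eq_inv_mul_of_mul_eq hab]
  exact hu.inv_right.mul_right hu'

theorem MulHom.exists_pow_mul_eq {S M : Type*} [Mul S] [Monoid M] (φ : S →ₙ* M) (a b : S) (n : ℕ) :
    ∃ s, φ a ^ n * φ b = φ s := by
  induction n with
  | zero => exact ⟨b, by simp⟩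
  | succ n ih =>
    obtain ⟨s, hs⟩ := ih
    exact ⟨a * s, by rw [pow_succ', mul_assoc, hs, map_mul]⟩

theorem exists_mem_center_mul_mem_range (hfc : ∀ g : G, (Subgroup.centralizer {g}).FiniteIndex)
    (hφ : ∀ g, ∃ a b, φ a * g = φ b) (g : G) : ∃ z ∈ Subgroup.center G, ∃ s, z * g = φ s := by
  obtain ⟨a, b, hab⟩ := hφ g
  obtain ⟨n, hn, hz⟩ := Subgroup.exists_pow_mem_center hfc (φ a)
  obtain ⟨n, rfl⟩ := Nat.exists_eq_succ_of_ne_zero hn.ne'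
  refine ⟨_, hz, ?_⟩
  rw [Nat.succ_eq_add_one, pow_succ, mul_assoc, hab]
  exact φ.exists_pow_mul_eq a b n

theorem IsCentrallyEssential.commute_of_commute_pow_of_range [IsCancelMul S]
    (h : IsCentrallyEssential (MonoidAlgebra F S))
    (hinj : Function.Injective φ) (hφ : ∀ g, ∃ a b, φ a * g = φ b) (s t : S) {m : ℕ}
    (hm : (m : F) ≠ 0) (hst : Commute (φ s ^ m) (φ t)) : Commute (φ s) (φ t) := by
  obtain ⟨n, rfl⟩ := Nat.exists_eq_succ_of_ne_zero (by rintro rfl; simp at hm : m ≠ 0)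
  let ι := MonoidAlgebra.of F G
  let U : (MonoidAlgebra F G)ˣ := Units.map ι (toUnits (φ s))
  have hU : (U : MonoidAlgebra F G) = ι (φ s) := rfl
  have hU' : (↑U⁻¹ : MonoidAlgebra F G) = ι (φ s)⁻¹ := rfl
  obtain ⟨p, hp⟩ := φ.exists_pow_mul_eq s (s * t) n
  obtain ⟨q, hq⟩ := φ.exists_pow_mul_eq s (t * s) n
  have hpU : (U : MonoidAlgebra F G) ^ (n + 1) * ι (φ t) = ι (φ p) := by
    rw [← hp, hU, ← map_pow, ← map_mul, pow_succ, mul_assoc, map_mul φ]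
  have hqU : (↑U⁻¹ : MonoidAlgebra F G) * ι (φ p) * U = ι (φ q) := by
    rw [← hp, ← hq, hU, hU', ← map_mul, ← map_mul, map_mul φ, map_mul φ]
    congr 1
    simp only [← mul_assoc, mul_left_inj]
    rw [mul_assoc, ← pow_succ, pow_succ', inv_mul_cancel_left]
  have hzero := fun x => mul_eq_zero_of_mem_center_of_commute_pow (R := MonoidAlgebra F G) U
    (r := ι (φ t)) (x := x) (m := n + 1)
    (fun v hv => by
      rw [← Nat.cast_smul_eq_nsmul F] at hv
      exact (smul_eq_zero.1 hv).resolve_left hm)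
    (by rw [hU, ← map_pow]; exact hst.map ι)
  rw [hpU, hqU] at hzero
  have hα : MonoidAlgebra.mapDomain φ (MonoidAlgebra.single p 1 - MonoidAlgebra.single q 1) =
      ι (φ p) - ι (φ q) := by
    change MonoidAlgebra.mapDomainNonUnitalRingHom F φ _ = _
    rw [map_sub]
    congr 1 <;> exact MonoidAlgebra.mapDomain_single
  have hc : ι (φ p) - ι (φ q) ∈ Subring.center (MonoidAlgebra F G) := by
    by_contra hc
    rw [← hα] at hc hzero
    obtain ⟨x, hx, hax, hne⟩ := MonoidAlgebra.exists_mapDomain_mul_mem_center h hinj hφ _ hc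
    exact hne (hzero x hx hax)
  have h1 := hzero 1 (Subring.one_mem _) (by rwa [mul_one])
  rw [mul_one, sub_eq_zero] at h1
  have h2 := MonoidAlgebra.of_injective h1
  rw [← hp, ← hq, map_mul, map_mul] at h2
  exact mul_left_cancel h2

theorem IsCentrallyEssential.commute_of_commute_pow [IsCancelMul S]
    (h : IsCentrallyEssential (MonoidAlgebra F S))
    (hinj : Function.Injective φ) (hφ : ∀ g, ∃ a b, φ a * g = φ b) {u r : G} {m : ℕ}
    (hm : (m : F) ≠ 0) (hur : Commute (u ^ m) r) : Commute u r := by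
  have hfc := h.finiteIndex_centralizer hinj hφ
  obtain ⟨z, hz, s, hs⟩ := exists_mem_center_mul_mem_range hfc hφ u
  obtain ⟨y, hy, t, ht⟩ := exists_mem_center_mul_mem_range hfc hφ r
  have hz : ∀ g, Commute z g := fun g => (Subgroup.mem_center_iff.1 hz g).symm
  have hy : ∀ g, Commute y g := fun g => (Subgroup.mem_center_iff.1 hy g).symm
  have hst := h.commute_of_commute_pow_of_range hinj hφ s t hm (by
    rw [← hs, ← ht, (hz u).mul_pow]
    exact (((hz _).pow_left m).mul_left ((hy _).symm.mul_right hur)))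
  rw [← inv_mul_eq_of_eq_mul hs.symm, ← inv_mul_eq_of_eq_mul ht.symm]
  exact ((hz _).inv_left).mul_left ((hy _).inv_left.symm.mul_right hst)

end Fractions

theorem IsNonZeroDivisor.mul {R : Type*} [NonUnitalSemiring R] {a b : R} (ha : IsNonZeroDivisor a)
    (hb : IsNonZeroDivisor b) : IsNonZeroDivisor (a * b) :=
  ⟨fun x hx => hb.1 x (ha.1 _ (by rwa [← mul_assoc])),
    fun x hx => ha.2 x (hb.2 _ (by rwa [mul_assoc]))⟩

/-- If `S` is a cancellative semigroup and the semigroup algebra `F[S]` is centrally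
essential, then for every non-zero-divisor `b ∈ F[S]` there exists a non-zero-divisor
`z ∈ F[S]` with `b * z ∈ Z(F[S])`. -/
theorem stmt9 (F : Type*) [Field F] (S : Type*) [Semigroup S] [IsCancelMul S]
    (h : IsCentrallyEssential (MonoidAlgebra F S)) :
    ∀ b : MonoidAlgebra F S, IsNonZeroDivisor b →
      ∃ z : MonoidAlgebra F S, IsNonZeroDivisor z ∧ b * z ∈ Set.center (MonoidAlgebra F S) := by
  intro b hb
  rcases isEmpty_or_nonempty S with _ | _
  · refine ⟨b, hb, Semigroup.mem_center_iff.2 fun x => ?_⟩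
    ext s
    exact isEmptyElim s
  obtain ⟨G, _, φ, hinj, hφ⟩ := exists_group_of_ore h.exists_mul_eq_mul
  obtain ⟨n, hn, hbn⟩ := MonoidAlgebra.exists_pow_mem_center_of_finiteIndex_centralizer
    (h.finiteIndex_centralizer hinj hφ) (fun _ _ _ => h.commute_of_commute_pow hinj hφ)
    (MonoidAlgebra.mapDomain φ b)
  have hpow : ∀ j, ∃ z, IsNonZeroDivisor z ∧
      MonoidAlgebra.mapDomain φ z = MonoidAlgebra.mapDomain φ b ^ (j + 1) := by
    intro j
    induction j with
    | zero => exact ⟨b, hb, (pow_one _).symm⟩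
    | succ j ih =>
      obtain ⟨z, hz, hzb⟩ := ih
      exact ⟨z * b, hz.mul hb, by rw [MonoidAlgebra.mapDomain_mul, hzb, ← pow_succ]⟩
  obtain ⟨z, hz, hzb⟩ := hpow (2 * n - 2)
  have hbz : MonoidAlgebra.mapDomain φ (b * z) ∈ Subring.center (MonoidAlgebra F G) := by
    rw [MonoidAlgebra.mapDomain_mul, hzb, ← pow_succ', show 2 * n - 2 + 1 + 1 = n + n by omega,
      pow_add]
    exact Subring.mul_mem _ hbn hbn
  refine ⟨z, hz, Semigroup.mem_center_iff.2 fun x => MonoidAlgebra.mapDomain_injective hinj ?_⟩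
  rw [MonoidAlgebra.mapDomain_mul, Subring.mem_center_iff.1 hbz, ← MonoidAlgebra.mapDomain_mul]
end
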